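/- Fix an integer k ≥ 2, reals α, β ∈ (0,1) with α + β ≥ 1, and a function ℓ : ℕ → ℕ with ℓ(n) ≥ 2 for all n and ℓ(n) = o(√n). Then there exists N such that for every integer n ≥ N, both of the following hold: (1) C(n,k)·(1 − 1/(2(2ℓ(n)−1)²)) ≤ C(n−k,k); and (2) (Σ_{1 ≤ i < (1−α)k} C(k,i)·C(n−k,i)) · (Σ_{1 ≤ i < (1−β)k} C(k,i)·C(n−k,i)) ≤ (C(n,k) − 1)/(5ℓ(n)(2ℓ(n)−1)). -/

import Mathlib

theorem Nat.choose_le_choose_sub_add (n k j : ℕ) :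
    (n + 1).choose (k + 1) ≤ (n + 1 - j).choose (k + 1) + j * n.choose k := by
  induction j with
  | zero => simp
  | succ j ih =>
    have step : (n + 1 - j).choose (k + 1) ≤ (n + 1 - (j + 1)).choose (k + 1) + n.choose k := by
      rcases le_or_gt (n + 1) j with h | h
      · simp [Nat.sub_eq_zero_of_le h]
      · obtain ⟨m, hm⟩ : ∃ m, n + 1 - j = m + 1 := ⟨n - j, by omega⟩
        have hm' : n + 1 - (j + 1) = m := by omega
        rw [hm, hm', Nat.choose_succ_succ, add_comm]
        gcongr
        omega
    linarith

theorem Nat.mul_choose_le_mul_choose_sub_add (n k : ℕ) (hk : 1 ≤ k) (hn : 1 ≤ n) :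
    n * n.choose k ≤ n * (n - k).choose k + k ^ 2 * n.choose k := by
  obtain ⟨n, rfl⟩ := Nat.exists_eq_add_of_le' hn
  obtain ⟨k, rfl⟩ := Nat.exists_eq_add_of_le' hk
  have h := Nat.mul_le_mul_left (n + 1) (Nat.choose_le_choose_sub_add n k (k + 1))
  have e := Nat.add_one_mul_choose_eq n k
  calc _ ≤ _ := h
    _ = (n + 1) * (n + 1 - (k + 1)).choose (k + 1) + (k + 1) * ((n + 1) * n.choose k) := by ring
    _ = _ := by rw [e]; ring

theorem Nat.pow_le_two_pow_mul_factorial_mul_choose (n k : ℕ) (hn : 2 * k ≤ n) :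
    n ^ k ≤ 2 ^ k * k.factorial * n.choose k := by
  have h : (n + 1 - k) ^ k ≤ k.factorial * n.choose k := by
    rw [← Nat.descFactorial_eq_factorial_mul_choose]
    exact Nat.pow_sub_le_descFactorial n k
  calc n ^ k ≤ (2 * (n + 1 - k)) ^ k := by gcongr; omega
    _ = 2 ^ k * (n + 1 - k) ^ k := mul_pow ..
    _ ≤ 2 ^ k * (k.factorial * n.choose k) := by gcongr
    _ = _ := by ring

open Classical in
theorem sum_choose_mul_sum_choose_le (n k : ℕ) (hn : 1 ≤ n) (a b : ℝ) (hab : a + b ≤ k) :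
    (∑ i ∈ Finset.Ico 1 (k + 1),
        if (i : ℝ) < a then (k.choose i * (n - k).choose i : ℝ) else 0) *
      (∑ i ∈ Finset.Ico 1 (k + 1),
        if (i : ℝ) < b then (k.choose i * (n - k).choose i : ℝ) else 0) ≤
      k ^ 2 * (4 ^ k * n ^ (k - 1)) := by
  have hn' : (1 : ℝ) ≤ n := by exact_mod_cast hn
  have bound (i : ℕ) : (k.choose i * (n - k).choose i : ℝ) ≤ 2 ^ k * n ^ i := by
    have h₁ : k.choose i ≤ 2 ^ k := Nat.choose_le_two_pow k i
    have h₂ : (n - k).choose i ≤ n ^ i :=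
      (Nat.choose_le_pow _ _).trans (Nat.pow_le_pow_left (Nat.sub_le n k) i)
    exact_mod_cast Nat.mul_le_mul h₁ h₂
  have term (i j : ℕ) :
      (if (i : ℝ) < a then (k.choose i * (n - k).choose i : ℝ) else 0) *
        (if (j : ℝ) < b then (k.choose j * (n - k).choose j : ℝ) else 0) ≤
        4 ^ k * n ^ (k - 1) := by
    split_ifs with hi hj
    · have hij : i + j < k := by
        have : (i : ℝ) + j < k := by linarith
        exact_mod_cast this
      calc _ ≤ ((2 : ℝ) ^ k * n ^ i) * (2 ^ k * n ^ j) :=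
            mul_le_mul (bound i) (bound j) (by positivity) (by positivity)
        _ = 4 ^ k * n ^ (i + j) := by
            rw [show (4 : ℝ) = 2 * 2 by norm_num, mul_pow, pow_add]; ring
        _ ≤ _ := by gcongr; omega
    all_goals simp only [mul_zero, zero_mul]; positivity
  rw [Finset.sum_mul_sum]
  calc _ ≤ ∑ i ∈ Finset.Ico 1 (k + 1), ∑ j ∈ Finset.Ico 1 (k + 1),
        (4 ^ k * n ^ (k - 1) : ℝ) :=
        Finset.sum_le_sum fun i _ => Finset.sum_le_sum fun j _ => term i j
    _ = _ := by simp; ring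

theorem eventually_sq_le_of_isLittleO_sqrt {ℓ : ℕ → ℕ}
    (hℓ : (fun n : ℕ => (ℓ n : ℝ)) =o[Filter.atTop] fun n : ℕ => Real.sqrt n)
    {c : ℝ} (hc : 0 < c) : ∀ᶠ n : ℕ in Filter.atTop, (ℓ n : ℝ) ^ 2 ≤ c * n := by
  filter_upwards [hℓ.bound (Real.sqrt_pos.mpr hc)] with n hn
  rw [Real.norm_natCast, Real.norm_of_nonneg (Real.sqrt_nonneg _)] at hn
  calc (ℓ n : ℝ) ^ 2 ≤ (Real.sqrt c * Real.sqrt n) ^ 2 := by gcongr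
    _ = c * n := by rw [mul_pow, Real.sq_sqrt hc.le, Real.sq_sqrt n.cast_nonneg]

open Classical in
theorem stmt15 (k : ℕ) (hk : 2 ≤ k) (α β : ℝ) (hα : α ∈ Set.Ioo (0 : ℝ) 1)
    (hβ : β ∈ Set.Ioo (0 : ℝ) 1) (hαβ : 1 ≤ α + β)
    (ℓ : ℕ → ℕ) (hℓ2 : ∀ n, 2 ≤ ℓ n)
    (hℓo : (fun n : ℕ => (ℓ n : ℝ)) =o[Filter.atTop] fun n : ℕ => Real.sqrt n) :
    ∃ N : ℕ, ∀ n : ℕ, N ≤ n →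
      ((n.choose k : ℝ) * (1 - 1 / (2 * (2 * (ℓ n : ℝ) - 1) ^ 2)) ≤
          ((n - k).choose k : ℝ)) ∧
      ((∑ i ∈ Finset.Ico 1 (k + 1),
            if (i : ℝ) < (1 - α) * k then (k.choose i * (n - k).choose i : ℝ) else 0) *
          (∑ i ∈ Finset.Ico 1 (k + 1),
            if (i : ℝ) < (1 - β) * k then (k.choose i * (n - k).choose i : ℝ) else 0) ≤
          ((n.choose k : ℝ) - 1) / (5 * (ℓ n : ℝ) * (2 * (ℓ n : ℝ) - 1))) := by
  set D : ℝ := 20 * k ^ 2 * 8 ^ k * k.factorial with hD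
  have hk' : (2 : ℝ) ≤ k := by exact_mod_cast hk
  have hf : (1 : ℝ) ≤ k.factorial := by exact_mod_cast k.factorial_pos
  have hDpos : 0 < D := by positivity
  obtain ⟨M, hM⟩ := Filter.eventually_atTop.mp
    (eventually_sq_le_of_isLittleO_sqrt hℓo (inv_pos.mpr hDpos))
  refine ⟨max M (2 ^ (k + 1) * k.factorial + 2 * k), fun n hn => ?_⟩
  have hnK : 2 ^ (k + 1) * k.factorial + 2 * k ≤ n := le_trans (le_max_right _ _) hn
  have hn1 : 1 ≤ n := by omega
  have hn0 : (0 : ℝ) < n := by exact_mod_cast hn1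
  have hℓ : D * (ℓ n : ℝ) ^ 2 ≤ n := by
    have := hM n (le_trans (le_max_left _ _) hn)
    rwa [inv_mul_eq_div, le_div_iff₀' hDpos] at this
  have hℓ2' : (2 : ℝ) ≤ ℓ n := by exact_mod_cast hℓ2 n
  generalize (ℓ n : ℝ) = L at hℓ hℓ2'
  constructor
  · have key : (n : ℝ) * n.choose k ≤ n * (n - k).choose k + k ^ 2 * n.choose k := by
      exact_mod_cast Nat.mul_choose_le_mul_choose_sub_add n k (by omega) hn1
    have hden : (0 : ℝ) < 2 * (2 * L - 1) ^ 2 := by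
      have : 0 < 2 * L - 1 := by linarith
      positivity
    have hDk : 8 * (k : ℝ) ^ 2 ≤ D := by
      have h8 : (1 : ℝ) ≤ 8 ^ k * k.factorial := one_le_mul_of_one_le_of_one_le
        (one_le_pow₀ (by norm_num)) hf
      calc 8 * (k : ℝ) ^ 2 ≤ 20 * (k : ℝ) ^ 2 * 1 := by nlinarith
        _ ≤ 20 * (k : ℝ) ^ 2 * (8 ^ k * k.factorial) := by gcongr
        _ = D := by rw [hD]; ring
    have hsq : 2 * (2 * L - 1) ^ 2 ≤ 8 * L ^ 2 := by nlinarith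
    have hratio : (k : ℝ) ^ 2 / n ≤ 1 / (2 * (2 * L - 1) ^ 2) := by
      rw [div_le_div_iff₀ hn0 hden]
      calc (k : ℝ) ^ 2 * (2 * (2 * L - 1) ^ 2) ≤ k ^ 2 * (8 * L ^ 2) := by gcongr
        _ = (8 * k ^ 2) * L ^ 2 := by ring
        _ ≤ D * L ^ 2 := by gcongr
        _ ≤ 1 * n := by linarith
    calc (n.choose k : ℝ) * (1 - 1 / (2 * (2 * L - 1) ^ 2))
        ≤ (n.choose k : ℝ) * (1 - (k : ℝ) ^ 2 / n) := by gcongr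
      _ = ((n : ℝ) * n.choose k - (k : ℝ) ^ 2 * n.choose k) / n := by field_simp
      _ ≤ ((n - k).choose k : ℝ) := by rw [div_le_iff₀ hn0]; linarith
  · have hpow : (n : ℝ) ^ k ≤ 2 ^ k * k.factorial * n.choose k := by
      exact_mod_cast Nat.pow_le_two_pow_mul_factorial_mul_choose n k (by omega)
    have hP : (0 : ℝ) < 2 ^ k * k.factorial := by positivity
    have hC2 : (2 : ℝ) ≤ n.choose k := by
      have h₁ : (2 : ℝ) ^ (k + 1) * k.factorial ≤ n := by
        exact_mod_cast (Nat.le_add_right _ _).trans hnK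
      have h₂ : (n : ℝ) ≤ n ^ k := le_self_pow₀ (by exact_mod_cast hn1) (by omega)
      refine le_of_mul_le_mul_left ?_ hP
      calc _ = (2 : ℝ) ^ (k + 1) * k.factorial := by ring
        _ ≤ _ := h₁.trans (h₂.trans hpow)
    refine (sum_choose_mul_sum_choose_le n k hn1 _ _ ?_).trans ?_
    · nlinarith
    have hden : 0 < 5 * L * (2 * L - 1) := by
      have : 0 < 2 * L - 1 := by linarith
      positivity
    rw [le_div_iff₀ hden]
    have hquad : 5 * L * (2 * L - 1) ≤ 10 * L ^ 2 := by nlinarith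
    suffices (k : ℝ) ^ 2 * (4 ^ k * n ^ (k - 1)) * (5 * L * (2 * L - 1)) ≤ n.choose k / 2 by
      linarith
    refine le_of_mul_le_mul_left ?_ (mul_pos two_pos hP)
    calc 2 * (2 ^ k * k.factorial) *
          ((k : ℝ) ^ 2 * (4 ^ k * n ^ (k - 1)) * (5 * L * (2 * L - 1)))
        ≤ 2 * (2 ^ k * k.factorial) * ((k : ℝ) ^ 2 * (4 ^ k * n ^ (k - 1)) * (10 * L ^ 2)) := by
          gcongr
      _ = n ^ (k - 1) * (D * L ^ 2) := by
          rw [hD, show (8 : ℝ) = 2 * 4 by norm_num, mul_pow]; ring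
      _ ≤ n ^ (k - 1) * n := by gcongr
      _ = n ^ k := pow_sub_one_mul (by omega) _
      _ ≤ 2 ^ k * k.factorial * n.choose k := hpow
      _ = _ := by ring
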